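/- arXiv:math/0412277 — 2 statements merged into one kernel-verified Lean document; each statement's English description precedes it below -/
import Mathlib

section
/- For s > 1, the operator Mf(x) = ∑_{n=1}^∞ μ(n) f(nx), where μ is the Möbius function, is a bounded operator on L²((0,∞), x^{2s} dx/x), and M is a two-sided inverse of the Zeta operator Zf(x) = ∑_{n=1}^∞ f(nx) on this space. -/
open MeasureTheory Set Real

/-- The measure `x^{2s} dx/x = x^{2s-1} dx` on `(0,∞)`. -/
noncomputable def wMeasure (s : ℝ) : Measure ℝ :=
  (volume.restrict (Ioi (0 : ℝ))).withDensity fun x => ENNReal.ofReal (x ^ (2 * s - 1))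

/-- Dilation by `a > 0` rescales the measure `x^{2s} dx/x` by `a^{-2s}`. -/
theorem map_mul_left_wMeasure (s : ℝ) {a : ℝ} (ha : 0 < a) :
    (wMeasure s).map (a * ·) = ENNReal.ofReal (a ^ (-(2 * s))) • wMeasure s := by
  have hw : Measurable fun x : ℝ => ENNReal.ofReal (x ^ (2 * s - 1)) := by fun_prop
  ext A hA
  have hpre : MeasurableSet ((a * ·) ⁻¹' A) := measurable_const_mul a hA
  set G : ℝ → ENNReal := (Ioi (0 : ℝ) ∩ A).indicator fun y => ENNReal.ofReal (y ^ (2 * s - 1))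
  have hG : Measurable G := hw.indicator (measurableSet_Ioi.inter hA)
  have hwA (B : Set ℝ) (hB : MeasurableSet B) : wMeasure s B =
      ∫⁻ x, (Ioi (0 : ℝ) ∩ B).indicator (fun y => ENNReal.ofReal (y ^ (2 * s - 1))) x := by
    rw [wMeasure, withDensity_apply _ hB, Measure.restrict_restrict hB,
      lintegral_indicator (measurableSet_Ioi.inter hB), inter_comm]
  have hscale (x : ℝ) :
      ((Ioi (0 : ℝ) ∩ (a * ·) ⁻¹' A).indicator fun y => ENNReal.ofReal (y ^ (2 * s - 1))) x =
        ENNReal.ofReal (a ^ (1 - 2 * s)) * G (a * x) := by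
    by_cases hx : 0 < x ∧ a * x ∈ A
    · have h1 : x ∈ Ioi (0 : ℝ) ∩ (a * ·) ⁻¹' A := hx
      have h2 : a * x ∈ Ioi (0 : ℝ) ∩ A := ⟨mul_pos ha hx.1, hx.2⟩
      rw [indicator_of_mem h1]
      simp only [G]
      rw [indicator_of_mem h2, ← ENNReal.ofReal_mul (by positivity),
        mul_rpow ha.le hx.1.le, ← mul_assoc, ← rpow_add ha]
      simp
    · have h1 : x ∉ Ioi (0 : ℝ) ∩ (a * ·) ⁻¹' A := hx
      have h2 : a * x ∉ Ioi (0 : ℝ) ∩ A := fun h => hx ⟨pos_of_mul_pos_right h.1 ha.le, h.2⟩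
      rw [indicator_of_notMem h1]
      simp only [G]
      rw [indicator_of_notMem h2, mul_zero]
  rw [Measure.map_apply (measurable_const_mul a) hA, hwA _ hpre, Measure.smul_apply, hwA A hA,
    smul_eq_mul, lintegral_congr hscale,
    lintegral_const_mul _ (by fun_prop),
    ← lintegral_map hG (measurable_const_mul a), Real.map_volume_mul_left ha.ne',
    lintegral_smul_measure, smul_eq_mul, ← mul_assoc, ← ENNReal.ofReal_mul (by positivity),
    abs_of_pos (inv_pos.2 ha), ← rpow_neg_one a, ← rpow_add ha]
  congr 3
  ring

theorem quasiMeasurePreserving_mul_left_wMeasure (s : ℝ) {a : ℝ} (ha : 0 < a) :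
    Measure.QuasiMeasurePreserving (a * ·) (wMeasure s) (wMeasure s) := by
  refine ⟨measurable_const_mul a, ?_⟩
  rw [map_mul_left_wMeasure s ha]
  exact Measure.smul_absolutelyContinuous

theorem eLpNorm_comp_mul_left_wMeasure (s : ℝ) {a : ℝ} (ha : 0 < a) {f : ℝ → ℂ}
    (hf : AEStronglyMeasurable f (wMeasure s)) :
    eLpNorm (fun x => f (a * x)) 2 (wMeasure s) =
      ENNReal.ofReal (a ^ (-s)) * eLpNorm f 2 (wMeasure s) := by
  have hf' : AEStronglyMeasurable f ((wMeasure s).map (a * ·)) := by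
    rw [map_mul_left_wMeasure s ha]
    exact hf.smul_measure _
  rw [← Function.comp_def f (a * ·), ← eLpNorm_map_measure hf' (by fun_prop),
    map_mul_left_wMeasure s ha, eLpNorm_smul_measure_of_ne_top (by simp), smul_eq_mul,
    ENNReal.ofReal_rpow_of_pos (by positivity), ← rpow_mul ha.le]
  congr 3
  rw [one_div, ENNReal.toReal_inv, ENNReal.toReal_ofNat]
  ring

theorem memLp_comp_mul_left_wMeasure (s : ℝ) {a : ℝ} (ha : 0 < a) {f : ℝ → ℂ}
    (hf : MemLp f 2 (wMeasure s)) : MemLp (fun x => f (a * x)) 2 (wMeasure s) := by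
  refine ⟨hf.1.comp_quasiMeasurePreserving (quasiMeasurePreserving_mul_left_wMeasure s ha), ?_⟩
  rw [eLpNorm_comp_mul_left_wMeasure s ha hf.1]
  exact ENNReal.mul_lt_top ENNReal.ofReal_lt_top hf.2

/-- The function `f (a ·)` as an element of `L²((0,∞), x^{2s} dx/x)`, for `a > 0`. -/
noncomputable def dilate (s a : ℝ) (ha : 0 < a) (f : Lp ℂ 2 (wMeasure s)) :
    Lp ℂ 2 (wMeasure s) :=
  (memLp_comp_mul_left_wMeasure s ha (Lp.memLp f)).toLp _

theorem dilate_coeFn (s : ℝ) {a : ℝ} (ha : 0 < a) (f : Lp ℂ 2 (wMeasure s)) :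
    dilate s a ha f =ᵐ[wMeasure s] fun x => f (a * x) :=
  MemLp.coeFn_toLp (memLp_comp_mul_left_wMeasure s ha (Lp.memLp f))

theorem norm_dilate (s : ℝ) {a : ℝ} (ha : 0 < a) (f : Lp ℂ 2 (wMeasure s)) :
    ‖dilate s a ha f‖ = a ^ (-s) * ‖f‖ := by
  rw [dilate, Lp.norm_toLp, eLpNorm_comp_mul_left_wMeasure s ha (Lp.aestronglyMeasurable f),
    ENNReal.toReal_mul, ENNReal.toReal_ofReal (by positivity), Lp.norm_def]

theorem dilate_add (s : ℝ) {a : ℝ} (ha : 0 < a) (f g : Lp ℂ 2 (wMeasure s)) :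
    dilate s a ha (f + g) = dilate s a ha f + dilate s a ha g := by
  apply Lp.ext
  filter_upwards [dilate_coeFn s ha (f + g), dilate_coeFn s ha f, dilate_coeFn s ha g,
    Lp.coeFn_add (dilate s a ha f) (dilate s a ha g),
    (quasiMeasurePreserving_mul_left_wMeasure s ha).ae (Lp.coeFn_add f g)] with x h₁ h₂ h₃ h₄ h₅
  rw [h₁, h₅, h₄, Pi.add_apply, Pi.add_apply, h₂, h₃]

theorem dilate_smul (s : ℝ) {a : ℝ} (ha : 0 < a) (c : ℂ) (f : Lp ℂ 2 (wMeasure s)) :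
    dilate s a ha (c • f) = c • dilate s a ha f := by
  apply Lp.ext
  filter_upwards [dilate_coeFn s ha (c • f), dilate_coeFn s ha f,
    Lp.coeFn_smul c (dilate s a ha f),
    (quasiMeasurePreserving_mul_left_wMeasure s ha).ae (Lp.coeFn_smul c f)] with x h₁ h₂ h₃ h₄
  rw [h₁, h₄, h₃, Pi.smul_apply, Pi.smul_apply, h₂]

/-- The dilation operator `f ↦ f (a ·)` on `L²((0,∞), x^{2s} dx/x)`, for `a > 0`. -/
noncomputable def dilation (s a : ℝ) (ha : 0 < a) :
    Lp ℂ 2 (wMeasure s) →L[ℂ] Lp ℂ 2 (wMeasure s) :=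
  LinearMap.mkContinuous
    { toFun := dilate s a ha
      map_add' := dilate_add s ha
      map_smul' := dilate_smul s ha }
    (a ^ (-s)) fun f => (norm_dilate s ha f).le

theorem dilation_coeFn (s : ℝ) {a : ℝ} (ha : 0 < a) (f : Lp ℂ 2 (wMeasure s)) :
    dilation s a ha f =ᵐ[wMeasure s] fun x => f (a * x) :=
  dilate_coeFn s ha f

theorem norm_dilation_le (s : ℝ) {a : ℝ} (ha : 0 < a) : ‖dilation s a ha‖ ≤ a ^ (-s) :=
  LinearMap.mkContinuous_norm_le _ (by positivity) _

theorem dilation_one (s : ℝ) : dilation s 1 one_pos = 1 := by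
  ext1 f
  refine Lp.ext ((dilation_coeFn s one_pos f).trans ?_)
  simp

theorem dilation_mul (s : ℝ) {a b : ℝ} (ha : 0 < a) (hb : 0 < b) :
    dilation s (a * b) (mul_pos ha hb) = dilation s a ha * dilation s b hb := by
  ext1 f
  refine Lp.ext ((dilation_coeFn s (mul_pos ha hb) f).trans ?_)
  refine (((dilation_coeFn s ha (dilation s b hb f)).trans
    ((quasiMeasurePreserving_mul_left_wMeasure s ha).ae_eq_comp
      (dilation_coeFn s hb f))).trans (.of_forall fun x => ?_)).symm
  simp only [Function.comp_apply]
  congr 1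
  ring

/-- The product of two absolutely convergent Dirichlet-type series `∑ f(n) D(n)`, with `D`
multiplicative, is the series attached to the Dirichlet convolution of the coefficients. -/
theorem tsum_smul_mul_tsum_smul {A : Type*} [NormedRing A] [NormedAlgebra ℂ A] [CompleteSpace A]
    {D : ℕ+ → A} (hD : ∀ m n, D (m * n) = D m * D n) (f g : ArithmeticFunction ℂ)
    (hf : Summable fun n : ℕ+ => ‖f n • D n‖) (hg : Summable fun n : ℕ+ => ‖g n • D n‖) :
    (∑' n : ℕ+, f n • D n) * ∑' n : ℕ+, g n • D n = ∑' n : ℕ+, (f * g) n • D n := by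
  have hsum := summable_mul_of_summable_norm hf hg
  have hsigma := (sigmaAntidiagonalEquivProd.summable_iff.2 hsum).tsum_sigma'
    fun n => Summable.of_finite
  rw [tsum_mul_tsum_of_summable_norm hf hg, ← sigmaAntidiagonalEquivProd.tsum_eq]
  refine hsigma.trans (tsum_congr fun n => ?_)
  rw [tsum_fintype, ArithmeticFunction.mul_apply, Finset.sum_smul,
    ← Finset.sum_coe_sort (Nat.divisorsAntidiagonal n)]
  refine Finset.sum_congr rfl fun x _ => ?_
  have hx := Nat.mem_divisorsAntidiagonal.1 x.2
  have hn : n = (sigmaAntidiagonalEquivProd ⟨n, x⟩).1 * (sigmaAntidiagonalEquivProd ⟨n, x⟩).2 :=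
    PNat.eq hx.1.symm
  rw [Function.comp_apply, smul_mul_smul_comm, ← hD, ← hn]
  rfl

theorem summable_norm_smul_dilation {s : ℝ} (hs : 1 < s) {c : ℕ+ → ℂ} (hc : ∀ n, ‖c n‖ ≤ 1) :
    Summable fun n : ℕ+ => ‖c n • dilation s n (Nat.cast_pos.2 n.pos)‖ := by
  have hsum : Summable fun n : ℕ+ => ((n : ℕ) : ℝ) ^ (-s) :=
    (summable_nat_rpow.2 (by linarith)).comp_injective PNat.coe_injective
  refine hsum.of_nonneg_of_le (fun n => norm_nonneg _) fun n => ?_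
  rw [norm_smul]
  exact (mul_le_of_le_one_left (norm_nonneg _) (hc n)).trans (norm_dilation_le s _)

theorem tsum_smul_dilation_coeFn {s : ℝ} (hs : 1 < s) {c : ℕ+ → ℂ} (hc : ∀ n, ‖c n‖ ≤ 1)
    (f : Lp ℂ 2 (wMeasure s)) :
    (∑' n : ℕ+, c n • dilation s n (Nat.cast_pos.2 n.pos)) f =ᵐ[wMeasure s]
      fun x => ∑' n : ℕ+, c n * f (n * x) := by
  have hsum := summable_norm_smul_dilation hs hc
  have hsum_f : Summable fun n : ℕ+ => ‖(c n • dilation s n (Nat.cast_pos.2 n.pos)) f‖ :=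
    (hsum.mul_right ‖f‖).of_nonneg_of_le (fun n => norm_nonneg _)
      fun n => ContinuousLinearMap.le_opNorm _ f
  have happ : (∑' n : ℕ+, c n • dilation s n (Nat.cast_pos.2 n.pos)) f =
      ∑' n : ℕ+, (c n • dilation s n (Nat.cast_pos.2 n.pos)) f :=
    (ContinuousLinearMap.apply ℂ (Lp ℂ 2 (wMeasure s)) f).map_tsum hsum.of_norm
  have hterm : ∀ᵐ x ∂wMeasure s, ∀ n : ℕ+,
      (c n • dilation s n (Nat.cast_pos.2 n.pos)) f x = c n * f (n * x) := by
    refine ae_all_iff.2 fun n => ?_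
    filter_upwards [Lp.coeFn_smul (c n) (dilation s n (Nat.cast_pos.2 n.pos) f),
      dilation_coeFn s (Nat.cast_pos.2 n.pos) f] with x hx hx'
    rw [_root_.smul_apply, hx, Pi.smul_apply, hx', smul_eq_mul]
  rw [happ]
  filter_upwards [Lp.hasSum_coeFn_tsum (tsum_enorm_ne_top_iff_summable_norm.2 hsum_f), hterm]
    with x hx hx'
  rw [← hx.tsum_eq]
  exact tsum_congr hx'

/-- For `s > 1`, the Möbius operator `Mf(x) = ∑_{n≥1} μ(n) f(nx)` is a bounded operator
on `L²((0,∞), x^{2s} dx/x)` and is a two-sided inverse of the Zeta operator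
`Zf(x) = ∑_{n≥1} f(nx)`. -/
theorem moebiusOperator_inverse_of_zetaOperator (s : ℝ) (hs : 1 < s) :
    ∃ TZ TM : Lp ℂ 2 (wMeasure s) →L[ℂ] Lp ℂ 2 (wMeasure s),
      (∀ f : Lp ℂ 2 (wMeasure s),
        TZ f =ᵐ[wMeasure s] fun x => ∑' n : ℕ+, f (n * x)) ∧
      (∀ f : Lp ℂ 2 (wMeasure s),
        TM f =ᵐ[wMeasure s] fun x =>
          ∑' n : ℕ+, (ArithmeticFunction.moebius n : ℂ) * f (n * x)) ∧
      TZ.comp TM = ContinuousLinearMap.id ℂ _ ∧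
      TM.comp TZ = ContinuousLinearMap.id ℂ _ := by
  let z : ArithmeticFunction ℂ := ((ArithmeticFunction.zeta : ArithmeticFunction ℕ) :)
  let m : ArithmeticFunction ℂ := ((ArithmeticFunction.moebius : ArithmeticFunction ℤ) :)
  let D : ℕ+ → Lp ℂ 2 (wMeasure s) →L[ℂ] Lp ℂ 2 (wMeasure s) := fun n =>
    dilation s n (Nat.cast_pos.2 n.pos)
  have hz_apply (n : ℕ+) : z n = 1 := by simp [z]
  have hz (n : ℕ+) : ‖z n‖ ≤ 1 := by simp [hz_apply]
  have hm (n : ℕ+) : ‖m n‖ ≤ 1 := by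
    have := ArithmeticFunction.abs_moebius_le_one (n := n)
    simp only [m, ArithmeticFunction.intCoe_apply, Complex.norm_intCast]
    exact_mod_cast this
  have hD (k l : ℕ+) : D (k * l) = D k * D l := by
    simp only [D, ← dilation_mul, PNat.mul_coe, Nat.cast_mul]
  have hone : ∑' n : ℕ+, (1 : ArithmeticFunction ℂ) n • D n = 1 := by
    rw [tsum_eq_single 1]
    · simp [D, dilation_one]
    · intro n hn
      rw [ArithmeticFunction.one_apply_ne (by simpa using hn), zero_smul]
  have hzs := summable_norm_smul_dilation hs hz
  have hms := summable_norm_smul_dilation hs hm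
  refine ⟨∑' n : ℕ+, z n • D n, ∑' n : ℕ+, m n • D n, fun f => ?_,
    fun f => tsum_smul_dilation_coeFn hs hm f, ?_, ?_⟩
  · refine (tsum_smul_dilation_coeFn hs hz f).trans (.of_forall fun x => ?_)
    simp only [hz_apply, one_mul]
  · refine (tsum_smul_mul_tsum_smul hD z m hzs hms).trans ?_
    rw [ArithmeticFunction.coe_zeta_mul_coe_moebius, hone]
    rfl
  · refine (tsum_smul_mul_tsum_smul hD m z hms hzs).trans ?_
    rw [ArithmeticFunction.coe_moebius_mul_coe_zeta, hone]
    rfl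
end

section
/- For every even Schwartz function f on ℝ and every s ∈ ℂ with 0 < Re s < 1, one has ζ(1-s) · ∫₀^∞ (J𝓕f)(x) x^{s-1} dx = ζ(s) · ∫₀^∞ f(x) x^{s-1} dx, where J𝓕f(x) = x⁻¹ (𝓕f)(x⁻¹), interpreting both sides by analytic continuation of the a priori convergent Mellin integrals. -/
open MeasureTheory Set Complex Real

/-- Fourier transform with kernel `exp (2πi x y)`. -/
noncomputable def fourierT (f : ℝ → ℂ) (y : ℝ) : ℂ :=
  ∫ x : ℝ, f x * Complex.exp (2 * Real.pi * Complex.I * x * y)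

open scoped FourierTransform

lemma cpow_one_div_pi_mul_sq {y : ℝ} (hy : 0 < y) (w : ℂ) :
    (1 / ((π * y ^ 2 : ℝ) : ℂ)) ^ (w / 2) = (π : ℂ) ^ (-w / 2) * (y : ℂ) ^ (1 - w - 1) := by
  rw [one_div, ← ofReal_inv, mul_inv, ofReal_mul,
    mul_cpow_ofReal_nonneg (by positivity) (by positivity), ofReal_inv, ofReal_inv,
    inv_cpow _ _ (by rw [arg_ofReal_of_nonneg pi_pos.le]; exact pi_ne_zero.symm),
    inv_cpow _ _ (by rw [arg_ofReal_of_nonneg (by positivity)]; exact pi_ne_zero.symm),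
    ← cpow_neg, ← cpow_neg, ofReal_pow, ← cpow_nat_mul' (x := (y : ℂ)) (n := 2)]
  · congr 2 <;> push_cast <;> ring
  · rw [arg_ofReal_of_nonneg hy.le]; simp [pi_pos]
  · rw [arg_ofReal_of_nonneg hy.le]; simp [pi_pos.le]

/-- The Mellin transform of a Gaussian transform of `h` is a Gamma factor times the Mellin
transform of `h`. -/
lemma mellin_integral_mul_gaussian {h : ℝ → ℂ} {w : ℂ} (hw : 0 < w.re)
    (hm : AEStronglyMeasurable h (volume.restrict (Ioi 0))) (hh : MellinConvergent h (1 - w)) :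
    mellin (fun t ↦ ∫ y in Ioi (0 : ℝ), h y * cexp (-π * t * y ^ 2)) (w / 2)
      = Gammaℝ w * mellin h (1 - w) := by
  have hw2 : 0 < (w / 2).re := by simpa using hw
  set μ := volume.restrict (Ioi (0 : ℝ)) with hμ
  have hnorm {t y : ℝ} (ht : 0 < t) :
      ‖(t : ℂ) ^ (w / 2 - 1) * (h y * cexp (-π * t * y ^ 2))‖
        = ‖h y‖ * (t ^ ((w / 2).re - 1) * rexp (-(π * y ^ 2 * t))) := by
    have h1 : -(π : ℂ) * t * y ^ 2 = ((-(π * y ^ 2 * t) : ℝ) : ℂ) := by push_cast; ring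
    rw [norm_mul, norm_mul, norm_cpow_eq_rpow_re_of_pos ht, h1, norm_exp_ofReal, sub_re, one_re]
    ring
  have hint : Integrable (Function.uncurry fun t y : ℝ ↦
      (t : ℂ) ^ (w / 2 - 1) * (h y * cexp (-π * t * y ^ 2))) (μ.prod μ) := by
    have hmeas : AEStronglyMeasurable (Function.uncurry fun t y : ℝ ↦
        (t : ℂ) ^ (w / 2 - 1) * (h y * cexp (-π * t * y ^ 2))) (μ.prod μ) := by
      refine AEStronglyMeasurable.mul ?_ (hm.comp_snd.mul ?_)
      · exact (by fun_prop : Measurable fun p : ℝ × ℝ ↦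
          (p.1 : ℂ) ^ (w / 2 - 1)).aestronglyMeasurable
      · exact (by fun_prop : Continuous fun p : ℝ × ℝ ↦
          cexp (-π * p.1 * p.2 ^ 2)).aestronglyMeasurable
    rw [integrable_prod_iff' hmeas]
    constructor
    · filter_upwards [ae_restrict_mem measurableSet_Ioi] with y hy
      have hy : 0 < y := hy
      have h0 : Integrable (fun t : ℝ ↦ t ^ ((w / 2).re - 1) * rexp (-(π * y ^ 2 * t))) μ := by
        have := integral_rpow_mul_exp_neg_mul_Ioi hw2 (r := π * y ^ 2) (by positivity)
        refine not_imp_comm.1 integral_undef ?_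
        rw [this]
        have := Real.Gamma_pos_of_pos hw2
        positivity
      refine (h0.const_mul ‖h y‖).mono' ?_ ?_
      · exact (by fun_prop : Measurable fun t : ℝ ↦ (t : ℂ) ^ (w / 2 - 1) *
          (h y * cexp (-π * t * y ^ 2))).aestronglyMeasurable
      · filter_upwards [ae_restrict_mem measurableSet_Ioi] with t ht
        exact (hnorm ht).le
    · refine ((hh.norm).const_mul (π ^ (-w.re / 2) * Real.Gamma (w / 2).re)).congr ?_
      filter_upwards [ae_restrict_mem measurableSet_Ioi] with y hy
      have hy : 0 < y := hy
      have : ∫ t, ‖(t : ℂ) ^ (w / 2 - 1) * (h y * cexp (-π * t * y ^ 2))‖ ∂μ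
          = ∫ t, ‖h y‖ * (t ^ ((w / 2).re - 1) * rexp (-(π * y ^ 2 * t))) ∂μ :=
        setIntegral_congr_fun measurableSet_Ioi fun t ht ↦ hnorm ht
      simp only [Function.uncurry_apply_pair]
      rw [this, integral_const_mul, hμ,
        integral_rpow_mul_exp_neg_mul_Ioi hw2 (by positivity)]
      have h2 := congr_arg norm (cpow_one_div_pi_mul_sq hy w)
      rw [← ofReal_one, ← ofReal_div, norm_cpow_eq_rpow_re_of_pos (by positivity), norm_mul,
        norm_cpow_eq_rpow_re_of_pos pi_pos] at h2
      rw [h2, norm_smul]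
      simp
      ring
  have hswap := integral_integral_swap hint
  calc
    _ = ∫ t, ∫ y, (t : ℂ) ^ (w / 2 - 1) * (h y * cexp (-π * t * y ^ 2)) ∂μ ∂μ := by
      simp only [mellin, smul_eq_mul, integral_const_mul, hμ]
    _ = ∫ y, ∫ t, (t : ℂ) ^ (w / 2 - 1) * (h y * cexp (-π * t * y ^ 2)) ∂μ ∂μ := hswap
    _ = ∫ y, Gammaℝ w * ((y : ℂ) ^ (1 - w - 1) • h y) ∂μ := by
      refine setIntegral_congr_fun measurableSet_Ioi fun y (hy : 0 < y) ↦ ?_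
      have := integral_cpow_mul_exp_neg_mul_Ioi hw2 (r := π * y ^ 2) (by positivity)
      rw [cpow_one_div_pi_mul_sq hy] at this
      rw [Gammaℝ, smul_eq_mul]
      calc
        _ = ∫ t, h y * ((t : ℂ) ^ (w / 2 - 1) * cexp (-(((π * y ^ 2 : ℝ) : ℂ) * t))) ∂μ := by
          congr 1; ext t
          rw [show -(((π * y ^ 2 : ℝ) : ℂ) * t) = -π * t * y ^ 2 by push_cast; ring]
          ring
        _ = _ := by rw [integral_const_mul, hμ, this]; ring
    _ = _ := by rw [integral_const_mul, mellin]

lemma SchwartzMap.mellinConvergent (f : SchwartzMap ℝ ℂ) {s : ℂ} (hs : 0 < s.re) :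
    MellinConvergent f s := by
  refine mellinConvergent_of_isBigO_rpow (a := s.re + 1) (b := 0)
    (f.continuous.locallyIntegrable.locallyIntegrableOn _) ?_ (by simp) ?_ hs
  · refine ((f.isBigO_cocompact_rpow (-(s.re + 1))).mono atTop_le_cocompact).congr' .rfl ?_
    filter_upwards [Filter.eventually_ge_atTop 0] with x hx
    rw [Real.norm_of_nonneg hx]
  · simp only [neg_zero, rpow_zero]
    exact (f.continuous.tendsto 0).isBigO_one ℝ |>.mono nhdsWithin_le_nhds

lemma integral_eq_two_mul_integral_Ioi_of_even {g : ℝ → ℂ} (hg : Integrable g)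
    (he : ∀ x, g (-x) = g x) : ∫ x, g x = 2 * ∫ x in Ioi 0, g x := by
  rw [← intervalIntegral.integral_Iic_add_Ioi (b := 0) hg.integrableOn hg.integrableOn]
  have := integral_comp_neg_Ioi 0 g
  simp only [he, neg_zero] at this
  rw [← this]
  ring

lemma integrable_schwartz_mul_gaussian (f : SchwartzMap ℝ ℂ) {t : ℝ} (ht : 0 < t) :
    Integrable fun x : ℝ ↦ f x * cexp (-π * t * x ^ 2) := by
  refine f.integrable.mul_bdd (c := 1) (by fun_prop) (.of_forall fun x ↦ ?_)
  rw [norm_exp]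
  simp [← ofReal_pow]
  positivity

lemma fourierT_eq_fourier (f : SchwartzMap ℝ ℂ) (hf : ∀ x, f (-x) = f x) (y : ℝ) :
    fourierT f y = (𝓕 f) y := by
  rw [SchwartzMap.fourier_coe, fourier_real_eq_integral_exp_smul, fourierT,
    ← integral_neg_eq_self]
  congr 1; ext x
  rw [hf, smul_eq_mul, mul_comm]
  congr 2
  push_cast; ring

lemma fourier_even (f : SchwartzMap ℝ ℂ) (hf : ∀ x, f (-x) = f x) (y : ℝ) :
    (𝓕 f) (-y) = (𝓕 f) y := by
  rw [← fourierT_eq_fourier f hf, ← fourierT_eq_fourier f hf, fourierT, fourierT,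
    ← integral_neg_eq_self]
  simp [hf]

lemma integral_fourier_mul_gaussian (f : SchwartzMap ℝ ℂ) (hf : ∀ x, f (-x) = f x) {t : ℝ}
    (ht : 0 < t) :
    ∫ y in Ioi (0 : ℝ), (𝓕 f) y * cexp (-π * t * y ^ 2)
      = (t : ℂ) ^ (-1 / 2 : ℂ) * ∫ x in Ioi (0 : ℝ), f x * cexp (-π * (t⁻¹ : ℝ) * x ^ 2) := by
  have hg : Integrable fun x : ℝ ↦ cexp (-π * t * x ^ 2) := by
    simpa using integrable_cexp_neg_mul_sq (b := π * t) (by simp; positivity)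
  have key := VectorFourier.integral_fourierIntegral_smul_eq_flip (L := innerₗ ℝ)
    continuous_fourierChar continuous_inner (f.integrable (μ := volume)) hg
  have hG : VectorFourier.fourierIntegral 𝐞 volume (innerₗ ℝ).flip
      (fun x : ℝ ↦ cexp (-π * t * x ^ 2)) = 𝓕 fun x : ℝ ↦ cexp (-π * t * x ^ 2) := by
    rw [flip_innerₗ]; rfl
  rw [hG, fourier_gaussian_pi (by simpa using ht)] at key
  change ∫ y : ℝ, (𝓕 f) y * cexp (-π * t * y ^ 2) = ∫ x : ℝ, f x * _ at key
  have h2 : ∀ x : ℝ, f x * (1 / (t : ℂ) ^ (1 / 2 : ℂ) * cexp (-π / t * x ^ 2)) =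
      (t : ℂ) ^ (-1 / 2 : ℂ) * (f x * cexp (-π * (t⁻¹ : ℝ) * x ^ 2)) := fun x ↦ by
    rw [show (-1 / 2 : ℂ) = -(1 / 2) by ring, cpow_neg, ofReal_inv]
    ring_nf
  simp only [h2] at key
  rw [integral_const_mul,
    integral_eq_two_mul_integral_Ioi_of_even (integrable_schwartz_mul_gaussian _ ht)
      (by simp [fourier_even f hf]),
    integral_eq_two_mul_integral_Ioi_of_even (integrable_schwartz_mul_gaussian _ (inv_pos.2 ht))
      (by simp [hf])] at key
  linear_combination key / 2

lemma Gammaℝ_mul_mellin_fourier (f : SchwartzMap ℝ ℂ) (hf : ∀ x, f (-x) = f x) {s : ℂ}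
    (hs0 : 0 < s.re) (hs1 : s.re < 1) :
    Gammaℝ s * mellin (𝓕 f : SchwartzMap ℝ ℂ) (1 - s) = Gammaℝ (1 - s) * mellin f s := by
  have hs1' : 0 < (1 - s).re := by simpa using hs1
  have h1 := mellin_integral_mul_gaussian hs0 (𝓕 f).continuous.aestronglyMeasurable
    ((𝓕 f).mellinConvergent hs1')
  have h2 := mellin_integral_mul_gaussian (w := 1 - s) hs1' f.continuous.aestronglyMeasurable
    (f.mellinConvergent (by simpa using hs0))
  rw [sub_sub_cancel] at h2
  rw [← h1, ← h2]
  calc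
    _ = mellin (fun t : ℝ ↦ (t : ℂ) ^ (-1 / 2 : ℂ) • (fun u : ℝ ↦
          ∫ x in Ioi (0 : ℝ), f x * cexp (-π * u * x ^ 2)) t⁻¹) (s / 2) :=
      setIntegral_congr_fun measurableSet_Ioi fun t ht ↦ by
        simp only [integral_fourier_mul_gaussian f hf ht, smul_eq_mul]
    _ = _ := by
      rw [mellin_cpow_smul, mellin_comp_inv (fun u : ℝ ↦
        ∫ x in Ioi (0 : ℝ), f x * cexp (-π * u * x ^ 2))]
      congr 1; ring

/-- The functional equation `ζ(1-s)·(J𝓕f)^(s) = ζ(s)·f̂(s)` for even Schwartz `f`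
and `0 < Re s < 1`, where `J𝓕f(x) = x⁻¹ (𝓕f)(x⁻¹)`. -/
theorem functional_equation_even_schwartz (f : SchwartzMap ℝ ℂ)
    (hf : ∀ x : ℝ, f (-x) = f x) (s : ℂ) (hs0 : 0 < s.re) (hs1 : s.re < 1) :
    riemannZeta (1 - s) *
        ∫ x in Ioi (0 : ℝ), ((x : ℂ)⁻¹ * fourierT f x⁻¹) * (x : ℂ) ^ (s - 1)
      = riemannZeta s * ∫ x in Ioi (0 : ℝ), f x * (x : ℂ) ^ (s - 1) := by
  have hs1' : 0 < (1 - s).re := by simpa using hs1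
  have hR : ∫ x in Ioi (0 : ℝ), f x * (x : ℂ) ^ (s - 1) = mellin f s := by
    simp only [mellin, smul_eq_mul, mul_comm]
  have hL : ∫ x in Ioi (0 : ℝ), ((x : ℂ)⁻¹ * fourierT f x⁻¹) * (x : ℂ) ^ (s - 1)
      = mellin (𝓕 f : SchwartzMap ℝ ℂ) (1 - s) := by
    rw [show 1 - s = -(s + -1) by ring, ← mellin_comp_inv, ← mellin_cpow_smul]
    simp only [mellin, smul_eq_mul, cpow_neg_one, fourierT_eq_fourier f hf, mul_comm]
  have h0 := Gammaℝ_ne_zero_of_re_pos hs0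
  have h1 := Gammaℝ_ne_zero_of_re_pos hs1'
  rw [hL, hR, riemannZeta_def_of_ne_zero (s := s) (by rintro rfl; simp at hs0),
    riemannZeta_def_of_ne_zero (s := 1 - s) (by intro h; simp [h] at hs1'),
    completedRiemannZeta_one_sub]
  field_simp
  linear_combination completedRiemannZeta s * Gammaℝ_mul_mellin_fourier f hf hs0 hs1
end
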